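/- Assume (U1)–(U4) and the definitions of C_j, V and CM(w,ρ). Let R ⊆ [0,∞)^J be a compact convex set containing the origin with C_U := max_{c ∈ R} Σ_{j=1}^J c_j > 0, and let ρ ∈ R have all components equal, ρ_1 = … = ρ_J = C_U/J, and lie in the relative interior of the sum-capacity facet of R (there exists δ > 0 such that every c ∈ [0,∞)^J with Σ_j c_j = C_U and Σ_j |c_j − ρ_j| < δ belongs to R). Let Λ be a function on [0,∞)^J \ {0} such that for each q, Λ(q) maximizes c ↦ Σ_{j=1}^J U_j(q_j,c_j) over R ∩ {c : c_j = 0 for every j with q_j = 0}, and assume the radial homogeneity Λ(aq) = Λ(q) for every a > 0 and q ≠ 0. Let q*(w,ρ) denote the unique optimal solution of CM(w,ρ). Then for every ε > 0 there exists σ > 0 such that for every q ∈ [0,∞)^J with w := Σ_{j=1}^J q_j/μ_j ≥ ε and Σ_{j=1}^J |q_j − q*_j(w,ρ)| ≤ σ, one has Σ_{j=1}^J Λ_j(q) = Σ_{j=1}^J ρ_j = C_U (the full capacity of the system is utilized near the fixed point). -/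

import Mathlib

open Set Filter

open scoped Topology

/-- A `C²` function on the closed quadrant has a partial derivative in the second variable that is
continuous in the first variable. -/
lemma continuousOn_partial_snd {U dU : ℝ → ℝ → ℝ}
    (hC2 : ContDiffOn ℝ 2 (fun p : ℝ × ℝ => U p.1 p.2) (Ici 0 ×ˢ Ici 0))
    (hderiv : ∀ q c : ℝ, 0 ≤ q → 0 ≤ c → HasDerivWithinAt (U q) (dU q c) (Ici 0) c)
    {c : ℝ} (hc : 0 ≤ c) : ContinuousOn (fun q => dU q c) (Ici 0) := by
  have hS : UniqueDiffOn ℝ (Ici (0 : ℝ) ×ˢ Ici (0 : ℝ)) :=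
    (uniqueDiffOn_Ici 0).prod (uniqueDiffOn_Ici 0)
  have hcont := hC2.continuousOn_fderivWithin hS (by norm_num)
  have hline : ContinuousOn (fun q : ℝ => (q, c)) (Ici 0) := by fun_prop
  have hmaps : MapsTo (fun q : ℝ => (q, c)) (Ici 0) (Ici (0 : ℝ) ×ˢ Ici (0 : ℝ)) :=
    fun q hq => ⟨hq, hc⟩
  refine ((hcont.comp hline hmaps).clm_apply
    (continuousOn_const (c := ((0 : ℝ), (1 : ℝ))))).congr fun q hq => ?_
  have hd : DifferentiableWithinAt ℝ (fun p : ℝ × ℝ => U p.1 p.2)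
      (Ici (0 : ℝ) ×ˢ Ici (0 : ℝ)) (q, c) :=
    hC2.differentiableOn (by norm_num) (q, c) ⟨hq, hc⟩
  have hcurve : HasDerivWithinAt (fun x : ℝ => (q, x)) ((0 : ℝ), (1 : ℝ)) (Ici 0) c :=
    (hasDerivWithinAt_const c (Ici 0) q).prodMk (hasDerivWithinAt_id c (Ici 0))
  have hcomp := hd.hasFDerivWithinAt.comp_hasDerivWithinAt c hcurve (fun x hx => ⟨hq, hx⟩)
  exact (uniqueDiffOn_Ici (0 : ℝ) c hc).eq_deriv _ (hderiv q c hq hc) hcomp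

/-- A strictly concave function lies strictly below its tangent lines. -/
lemma StrictConcaveOn.lt_tangent {f : ℝ → ℝ} {f' x y : ℝ} {s : Set ℝ}
    (hf : StrictConcaveOn ℝ s f) (hx : x ∈ s) (hy : y ∈ s) (hd : HasDerivAt f f' x)
    (hxy : y ≠ x) : f y < f x + f' * (y - x) := by
  rcases lt_or_gt_of_ne hxy with h | h
  · have := hf.lt_slope_of_hasDerivAt hy hx h hd
    rw [slope_def_field, lt_div_iff₀ (by linarith)] at this
    linarith
  · have := hf.slope_lt_of_hasDerivAt hx hy h hd
    rw [slope_def_field, div_lt_iff₀ (by linarith)] at this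
    linarith

/-- If a separable integral cost is minimal along a ray on a short initial segment, its directional
derivative is nonnegative. -/
lemma directional_derivative_nonneg {J : ℕ} {μ q v : Fin J → ℝ} {g : Fin J → ℝ → ℝ}
    (hg : ∀ j, ContinuousOn (g j) (Ici 0)) (hq : ∀ j, 0 ≤ q j) {δ : ℝ} (hδ : 0 < δ)
    (hpos : ∀ t ∈ Ioo 0 δ, ∀ j, 0 ≤ q j + t * v j)
    (hmin : ∀ t ∈ Ioo 0 δ, ∑ j, (1 / μ j) * ∫ u in (0 : ℝ)..(q j), g j u ≤
      ∑ j, (1 / μ j) * ∫ u in (0 : ℝ)..(q j + t * v j), g j u) :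
    0 ≤ ∑ j, (1 / μ j) * (g j (q j) * v j) := by
  have hcont : ∀ j, Continuous (fun u => g j (max u 0)) := fun j =>
    (hg j).comp_continuous (by fun_prop) (fun u => le_max_right u 0)
  have hint : ∀ j x, 0 ≤ x → ∫ u in (0 : ℝ)..x, g j u = ∫ u in (0 : ℝ)..x, g j (max u 0) := by
    intro j x hx
    refine intervalIntegral.integral_congr fun u hu => ?_
    rw [uIcc_of_le hx] at hu
    simp only [max_eq_left hu.1]
  set f : ℝ → ℝ := fun t => ∑ j, (1 / μ j) * ∫ u in (0 : ℝ)..(q j + t * v j), g j (max u 0)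
    with hf
  have hfd : HasDerivAt f (∑ j, (1 / μ j) * (g j (q j) * v j)) 0 := by
    refine HasDerivAt.fun_sum fun j _ => HasDerivAt.const_mul _ ?_
    have hF : HasDerivAt (fun x => ∫ u in (0 : ℝ)..x, g j (max u 0))
        (g j (max (q j + 0 * v j) 0)) (q j + 0 * v j) :=
      (hcont j).integral_hasStrictDerivAt 0 _ |>.hasDerivAt
    have hl : HasDerivAt (fun t : ℝ => q j + t * v j) (v j) 0 := by
      simpa using ((hasDerivAt_id (0 : ℝ)).mul_const (v j)).const_add (q j)
    have := hF.comp (0 : ℝ) hl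
    simpa [hq j, Function.comp_def] using this
  have ht := hfd.tendsto_slope_zero_right
  refine ge_of_tendsto ht ?_
  filter_upwards [Ioo_mem_nhdsGT hδ] with t htm
  have h := hmin t htm
  have h0 : f 0 ≤ f t := by
    simp only [hf, zero_mul, add_zero]
    simpa only [fun j => hint j _ (hq j), fun j => hint j _ (hpos t htm j)] using h
  rw [zero_add, smul_eq_mul]
  exact mul_nonneg (inv_nonneg.2 htm.1.le) (by linarith)

/-- First-order conditions for minimizing a separable integral cost subject to a workload
constraint: the constraint is tight, the minimizer is positive and the marginal costs agree. -/
lemma workload_minimizer_first_order {J : ℕ} {μ q : Fin J → ℝ} {g : Fin J → ℝ → ℝ}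
    (hμ : ∀ j, 0 < μ j) (hg : ∀ j, ContinuousOn (g j) (Ici 0))
    (hmono : ∀ j, StrictMonoOn (g j) (Ici 0)) (hzero : ∀ j, g j 0 = 0)
    (hq : ∀ j, 0 ≤ q j) {w : ℝ} (hw : 0 < w) (hfeas : w ≤ ∑ j, q j / μ j)
    (hmin : ∀ x : Fin J → ℝ, (∀ j, 0 ≤ x j) → w ≤ ∑ j, x j / μ j →
      ∑ j, (1 / μ j) * ∫ u in (0 : ℝ)..(q j), g j u ≤
        ∑ j, (1 / μ j) * ∫ u in (0 : ℝ)..(x j), g j u) :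
    ∑ j, q j / μ j = w ∧ (∀ j, 0 < q j) ∧ ∀ j k, g j (q j) = g k (q k) := by
  have hgpos : ∀ j, 0 < q j → 0 < g j (q j) := fun j hj => by
    have := hmono j (mem_Ici.2 le_rfl) (mem_Ici.2 hj.le) hj
    rwa [hzero] at this
  have key : ∀ j k, 0 < q j → g j (q j) ≤ g k (q k) := by
    intro j k hj
    set v : Fin J → ℝ := Pi.single k (μ k) - Pi.single j (μ j) with hv
    have hj' := (hμ j).ne'
    have hk' := (hμ k).ne'
    have hnn : ∀ t ∈ Ioo 0 (q j / μ j), ∀ i, 0 ≤ q i + t * v i := by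
      intro t ht i
      have h1 : t * μ j ≤ q j := ((lt_div_iff₀ (hμ j)).1 ht.2).le
      have h2 : 0 ≤ t * (Pi.single k (μ k) : Fin J → ℝ) i := by
        rw [Pi.single_apply]
        split_ifs
        · exact mul_nonneg ht.1.le (hμ k).le
        · simp
      have h3 : t * (Pi.single j (μ j) : Fin J → ℝ) i ≤ q i := by
        rw [Pi.single_apply]
        split_ifs with hij
        · rwa [hij]
        · simpa using hq i
      rw [hv, Pi.sub_apply, mul_sub]
      linarith
    have h := directional_derivative_nonneg (μ := μ) hg hq (div_pos hj (hμ j)) hnn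
      fun t ht => hmin _ (hnn t ht) <| by
        have : ∑ i, (q i + t * v i) / μ i = ∑ i, q i / μ i := by
          simp [hv, add_div, mul_sub, sub_div, Finset.sum_add_distrib, Finset.sum_sub_distrib,
            Pi.single_apply, ite_div, hj', hk']
        rwa [this]
    simp only [hv, Pi.sub_apply, mul_sub, Finset.sum_sub_distrib, Pi.single_apply, mul_ite,
      mul_zero, Finset.sum_ite_eq', Finset.mem_univ, if_true] at h
    field_simp at h
    linarith
  obtain ⟨j₀, hj₀⟩ : ∃ j, 0 < q j := by
    by_contra! h
    have : ∑ j, q j / μ j ≤ 0 :=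
      Finset.sum_nonpos fun j _ => div_nonpos_of_nonpos_of_nonneg (h j) (hμ j).le
    linarith
  have hqpos : ∀ j, 0 < q j := by
    intro j
    refine lt_of_le_of_ne (hq j) fun h => ?_
    have := (hgpos j₀ hj₀).trans_le (key j₀ j hj₀)
    rw [← h, hzero] at this
    exact lt_irrefl _ this
  refine ⟨le_antisymm (not_lt.1 fun hlt => ?_) hfeas, hqpos,
    fun j k => le_antisymm (key j k (hqpos j)) (key k j (hqpos k))⟩
  set s := ∑ j, q j / μ j with hs
  have hspos : 0 < s := hw.trans hlt
  have hδ : 0 < (s - w) / s := div_pos (by linarith) hspos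
  have hδ1 : (s - w) / s < 1 := by rw [div_lt_one hspos]; linarith
  have hnn : ∀ t ∈ Ioo 0 ((s - w) / s), ∀ j, 0 ≤ q j + t * (-q j) := fun t ht j => by
    have := mul_nonneg (sub_nonneg.2 (ht.2.trans hδ1).le) (hq j)
    linarith
  have h := directional_derivative_nonneg (μ := μ) (q := q) (v := fun i => -q i) hg hq hδ hnn
    fun t ht => hmin _ (hnn t ht) <| by
      have h1 : ∑ j, (q j + t * (-q j)) / μ j = s - t * s := by
        rw [hs, Finset.mul_sum, ← Finset.sum_sub_distrib]
        exact Finset.sum_congr rfl fun j _ => by ring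
      have := (lt_div_iff₀ hspos).1 ht.2
      linarith
  refine absurd h (not_le.2 (Finset.sum_neg (fun j _ => ?_) ⟨j₀, Finset.mem_univ _⟩))
  have := mul_pos (one_div_pos.2 (hμ j)) (mul_pos (hgpos j (hqpos j)) (hqpos j))
  linarith

/-- A state with equal marginal costs is determined by its workload. -/
lemma eq_of_equal_marginals {J : ℕ} {μ x y : Fin J → ℝ} {g : Fin J → ℝ → ℝ}
    (hμ : ∀ j, 0 < μ j) (hmono : ∀ j, StrictMonoOn (g j) (Ici 0))
    (hx : ∀ j, 0 ≤ x j) (hy : ∀ j, 0 ≤ y j)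
    (hgx : ∀ j k, g j (x j) = g k (x k)) (hgy : ∀ j k, g j (y j) = g k (y k))
    (hxy : ∑ j, x j / μ j = ∑ j, y j / μ j) : x = y := by
  have aux : ∀ {x y : Fin J → ℝ}, (∀ j, 0 ≤ x j) → (∀ j, 0 ≤ y j) →
      (∀ j k, g j (x j) = g k (x k)) → (∀ j k, g j (y j) = g k (y k)) →
      ∑ j, x j / μ j = ∑ j, y j / μ j → ∀ i, ¬ x i < y i := by
    intro x y hx hy hgx hgy hxy i hi
    refine hxy.not_lt (Finset.sum_lt_sum_of_nonempty ⟨i, Finset.mem_univ i⟩ fun j _ => ?_)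
    refine div_lt_div_of_pos_right ?_ (hμ j)
    rw [← (hmono j).lt_iff_lt (hx j) (hy j), hgx j i, hgy j i]
    exact hmono i (hx i) (hy i) hi
  funext i
  exact le_antisymm (not_lt.1 (aux hy hx hgy hgx hxy.symm i)) (not_lt.1 (aux hx hy hgx hgy hxy i))

/-- If `ρ` maximizes a separable utility over small perturbations that preserve the coordinate sum,
then all marginal utilities at `ρ` agree. -/
lemma marginals_eq_of_max {J : ℕ} {ρ d : Fin J → ℝ} {f : Fin J → ℝ → ℝ} {R : Set (Fin J → ℝ)}
    {C : ℝ} (hρpos : ∀ j, 0 < ρ j) (hρ : ∑ j, ρ j = C)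
    (hfacet : ∃ δ > 0, ∀ c : Fin J → ℝ, (∀ j, 0 ≤ c j) → ∑ j, c j = C →
      ∑ j, |c j - ρ j| < δ → c ∈ R)
    (hd : ∀ j, HasDerivAt (f j) (d j) (ρ j))
    (hmax : ∀ c ∈ R, ∑ j, f j (c j) ≤ ∑ j, f j (ρ j)) (j k : Fin J) : d j = d k := by
  obtain ⟨δ, hδ, hR⟩ := hfacet
  set v : Fin J → ℝ := Pi.single k 1 - Pi.single j 1 with hv
  have hderiv : HasDerivAt (fun t : ℝ => ∑ i, f i (ρ i + t * v i)) (∑ i, d i * v i) 0 := by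
    refine HasDerivAt.fun_sum fun i _ => ?_
    have hl : HasDerivAt (fun t : ℝ => ρ i + t * v i) (v i) 0 := by
      simpa using ((hasDerivAt_id (0 : ℝ)).mul_const (v i)).const_add (ρ i)
    have hf : HasDerivAt (f i) (d i) (ρ i + 0 * v i) := by simpa using hd i
    exact hf.comp (0 : ℝ) hl
  have hloc : IsLocalMax (fun t : ℝ => ∑ i, f i (ρ i + t * v i)) 0 := by
    have h1 : ∀ᶠ t in 𝓝 (0 : ℝ), ∀ i, 0 < ρ i + t * v i := by
      refine eventually_all.2 fun i => ?_
      have : ContinuousAt (fun t : ℝ => ρ i + t * v i) 0 := by fun_prop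
      exact this.eventually_const_lt (by simpa using hρpos i)
    have h2 : ∀ᶠ t in 𝓝 (0 : ℝ), ∑ i, |ρ i + t * v i - ρ i| < δ := by
      have : ContinuousAt (fun t : ℝ => ∑ i, |ρ i + t * v i - ρ i|) 0 := by fun_prop
      exact this.eventually_lt_const (by simpa using hδ)
    filter_upwards [h1, h2] with t ht1 ht2
    have hs : ∑ i, (ρ i + t * v i) = C := by
      simp [hv, Finset.sum_add_distrib, ← Finset.mul_sum, Finset.sum_sub_distrib, hρ]
    simpa using hmax _ (hR _ (fun i => (ht1 i).le) hs ht2)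
  have h := hloc.hasDerivAt_eq_zero hderiv
  simp only [hv, Pi.sub_apply, mul_sub, Finset.sum_sub_distrib, Pi.single_apply, mul_ite,
    mul_one, mul_zero, Finset.sum_ite_eq', Finset.mem_univ, if_true] at h
  linarith

/-- A point of the sum-capacity hyperplane with equal positive marginal utilities is the strict
maximizer of a separable strictly concave utility below that hyperplane. -/
lemma sum_lt_of_equal_marginals {J : ℕ} {ρ c : Fin J → ℝ} {f : Fin J → ℝ → ℝ} {l : ℝ}
    (hl : 0 ≤ l) (hconc : ∀ j, StrictConcaveOn ℝ (Ici (0 : ℝ)) (f j))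
    (hρ : ∀ j, 0 ≤ ρ j) (hc : ∀ j, 0 ≤ c j) (hsum : ∑ j, c j ≤ ∑ j, ρ j)
    (hd : ∀ j, HasDerivAt (f j) l (ρ j)) (hne : c ≠ ρ) :
    ∑ j, f j (c j) < ∑ j, f j (ρ j) := by
  obtain ⟨i, hi⟩ := Function.ne_iff.1 hne
  have hlt : ∑ j, f j (c j) < ∑ j, (f j (ρ j) + l * (c j - ρ j)) := by
    refine Finset.sum_lt_sum (fun j _ => ?_) ⟨i, Finset.mem_univ i, ?_⟩
    · by_cases h : c j = ρ j
      · simp [h]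
      · exact ((hconc j).lt_tangent (hρ j) (hc j) (hd j) h).le
    · exact (hconc i).lt_tangent (hρ i) (hc i) (hd i) hi
  rw [Finset.sum_add_distrib, ← Finset.mul_sum, Finset.sum_sub_distrib] at hlt
  have := mul_nonneg hl (sub_nonneg.2 hsum)
  linarith

/-- near the fixed point q*(w,ρ) (with workload w bounded away
from zero), the utility-maximizing allocation Λ uses the full capacity:
Σ_j Λ_j(q) = Σ_j ρ_j = C_U. -/
theorem full_capacity_used_near_fixed_point
    (J : ℕ) (hJ : 1 ≤ J) (μ : Fin J → ℝ) (hμ : ∀ j, 0 < μ j)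
    (U dU : Fin J → ℝ → ℝ → ℝ)
    (hC2 : ∀ j, ContDiffOn ℝ 2 (fun p : ℝ × ℝ => U j p.1 p.2) (Ici 0 ×ˢ Ici 0))
    (hderiv : ∀ j, ∀ qv c : ℝ, 0 ≤ qv → 0 ≤ c →
      HasDerivWithinAt (U j qv) (dU j qv c) (Ici 0) c)
    (hU1 : ∀ j, ∀ c : ℝ, 0 ≤ c → U j 0 c = 0)
    (hU2mono : ∀ j, ∀ qv : ℝ, 0 < qv → StrictMonoOn (U j qv) (Ici (0 : ℝ)))
    (hU2conc : ∀ j, ∀ qv : ℝ, 0 < qv → StrictConcaveOn ℝ (Ici (0 : ℝ)) (U j qv))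
    (hU3 : ∀ j, ∀ c : ℝ, 0 < c → StrictMonoOn (fun qv => dU j qv c) (Ici (0 : ℝ)))
    (hU4zero : ∀ j, ∀ c : ℝ, 0 < c → dU j 0 c = 0)
    (hU4infty : ∀ j, ∀ c : ℝ, 0 < c → Tendsto (fun qv => dU j qv c) atTop atTop)
    (V : (Fin J → ℝ) → (Fin J → ℝ) → ℝ)
    (hV : ∀ q c : Fin J → ℝ, V q c = ∑ j, (1 / μ j) * ∫ u in (0 : ℝ)..(q j), dU j u (c j))
    -- the capacity region
    (R : Set (Fin J → ℝ)) (hRsub : R ⊆ {c | ∀ j, 0 ≤ c j})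
    (hRcomp : IsCompact R) (hRconv : Convex ℝ R) (hR0 : (0 : Fin J → ℝ) ∈ R)
    (C_U : ℝ) (hCUpos : 0 < C_U) (hCUub : ∀ c ∈ R, ∑ j, c j ≤ C_U)
    -- ρ : the equal-rate point of the sum-capacity facet, in its relative interior
    (ρ : Fin J → ℝ) (hρR : ρ ∈ R) (hρeq : ∀ j, ρ j = C_U / J)
    (hfacet : ∃ δ > 0, ∀ c : Fin J → ℝ, (∀ j, 0 ≤ c j) → ∑ j, c j = C_U →
      ∑ j, |c j - ρ j| < δ → c ∈ R)
    -- Λ : the utility-maximizing scheduling policy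
    (Λ : (Fin J → ℝ) → (Fin J → ℝ))
    (hΛmem : ∀ q : Fin J → ℝ, q ≠ 0 → (∀ j, 0 ≤ q j) →
      Λ q ∈ R ∧ (∀ j, q j = 0 → Λ q j = 0))
    (hΛmax : ∀ q : Fin J → ℝ, q ≠ 0 → (∀ j, 0 ≤ q j) →
      ∀ c ∈ R, (∀ j, q j = 0 → c j = 0) →
        ∑ j, U j (q j) (c j) ≤ ∑ j, U j (q j) (Λ q j))
    (hΛhom : ∀ a : ℝ, 0 < a → ∀ q : Fin J → ℝ, q ≠ 0 → (∀ j, 0 ≤ q j) →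
      Λ (a • q) = Λ q)
    -- q* : the unique optimal solution of CM(·,ρ)
    (qstar : ℝ → Fin J → ℝ)
    (hqstar : ∀ w : ℝ, 0 ≤ w →
      (∀ j, 0 ≤ qstar w j) ∧
      w ≤ ∑ j, qstar w j / μ j ∧
      (∀ q : Fin J → ℝ, (∀ j, 0 ≤ q j) → w ≤ ∑ j, q j / μ j →
        V (qstar w) ρ ≤ V q ρ) ∧
      (∀ q : Fin J → ℝ, (∀ j, 0 ≤ q j) → w ≤ ∑ j, q j / μ j →
        V q ρ = V (qstar w) ρ → q = qstar w)) :
    ∀ ε : ℝ, 0 < ε → ∃ σ : ℝ, 0 < σ ∧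
      ∀ q : Fin J → ℝ, (∀ j, 0 ≤ q j) →
        ε ≤ ∑ j, q j / μ j →
        ∑ j, |q j - qstar (∑ i, q i / μ i) j| ≤ σ →
        ∑ j, Λ q j = C_U := by
  have hne : Nonempty (Fin J) := ⟨⟨0, hJ⟩⟩
  have hρpos : ∀ j, 0 < ρ j := fun j => by
    rw [hρeq]
    exact div_pos hCUpos (by exact_mod_cast hJ)
  have hJ0 : (J : ℝ) ≠ 0 := by exact_mod_cast (show J ≠ 0 by omega)
  have hρsum : ∑ j, ρ j = C_U := by
    simp only [hρeq, Finset.sum_const, Finset.card_univ, Fintype.card_fin, nsmul_eq_mul]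
    field_simp
  have hdU : ∀ j, ∀ x : ℝ, 0 ≤ x → HasDerivAt (U j x) (dU j x (ρ j)) (ρ j) := fun j x hx =>
    (hderiv j x (ρ j) hx (hρpos j).le).hasDerivAt (Ici_mem_nhds (hρpos j))
  have hmono : ∀ j, StrictMonoOn (fun x => dU j x (ρ j)) (Ici 0) := fun j => hU3 j _ (hρpos j)
  have hstar : ∀ w, 0 < w → ∑ j, qstar w j / μ j = w ∧ (∀ j, 0 < qstar w j) ∧
      ∀ j k, dU j (qstar w j) (ρ j) = dU k (qstar w k) (ρ k) := by
    intro w hw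
    obtain ⟨h1, h2, h3, -⟩ := hqstar w hw.le
    refine workload_minimizer_first_order (g := fun j x => dU j x (ρ j)) hμ
      (fun j => continuousOn_partial_snd (hC2 j) (hderiv j) (hρpos j).le) hmono
      (fun j => hU4zero j _ (hρpos j)) h1 hw h2 fun x hx hxw => ?_
    simpa only [hV] using h3 x hx hxw
  have hstrict : ∀ w, 0 < w → ∀ c ∈ R, c ≠ ρ →
      ∑ j, U j (qstar w j) (c j) < ∑ j, U j (qstar w j) (ρ j) := by
    intro w hw c hc hcρ
    obtain ⟨-, hpos, heq⟩ := hstar w hw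
    let i := Classical.arbitrary (Fin J)
    have hl : 0 < dU i (qstar w i) (ρ i) := by
      have := hmono i (mem_Ici.2 le_rfl) (mem_Ici.2 (hpos i).le) (hpos i)
      simpa only [hU4zero i _ (hρpos i)] using this
    refine sum_lt_of_equal_marginals hl.le (fun j => hU2conc j _ (hpos j))
      (fun j => (hρpos j).le) (hRsub hc) (by rw [hρsum]; exact hCUub c hc) (fun j => ?_) hcρ
    rw [heq i j]
    exact hdU j _ (hpos j).le
  have hne0 : ∀ x : Fin J → ℝ, (∀ j, 0 < x j) → x ≠ 0 := fun x hx h =>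
    (hx (Classical.arbitrary _)).ne' (congrFun h _)
  have hΛstar : ∀ w, 0 < w → Λ (qstar w) = ρ := by
    intro w hw
    have hpos := (hstar w hw).2.1
    by_contra h
    have h1 := hstrict w hw _ (hΛmem _ (hne0 _ hpos) fun j => (hpos j).le).1 h
    have h2 := hΛmax _ (hne0 _ hpos) (fun j => (hpos j).le) ρ hρR
      fun j hj => absurd hj (hpos j).ne'
    linarith
  have hhom : ∀ w, 0 < w → ∀ a, 0 < a → a • qstar w = qstar (a * w) := by
    intro w hw a ha
    obtain ⟨hsum, hpos, -⟩ := hstar w hw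
    obtain ⟨hsum', hpos', heq'⟩ := hstar (a * w) (mul_pos ha hw)
    have hap : ∀ j, 0 < (a • qstar w) j := fun j => mul_pos ha (hpos j)
    have hΛa : Λ (a • qstar w) = ρ :=
      (hΛhom a ha _ (hne0 _ hpos) fun j => (hpos j).le).trans (hΛstar w hw)
    refine eq_of_equal_marginals (g := fun j x => dU j x (ρ j)) hμ hmono (fun j => (hap j).le)
      (fun j => (hpos' j).le) ?_ heq' ?_
    · refine marginals_eq_of_max hρpos hρsum hfacet (fun j => hdU j _ (hap j).le) fun c hc => ?_
      have := hΛmax _ (hne0 _ hap) (fun j => (hap j).le) c hc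
        fun j hj => absurd hj (hap j).ne'
      rwa [hΛa] at this
    · simp only [Pi.smul_apply, smul_eq_mul, mul_div_assoc, ← Finset.mul_sum, hsum, hsum']
  intro ε hε
  obtain ⟨-, hppos, -⟩ := hstar ε hε
  obtain ⟨δ, hδ, hδR⟩ := hfacet
  have hnear : ∀ᶠ c in 𝓝 ρ, (∀ j, 0 < c j) ∧ ∑ j, |C_U / (∑ i, c i) * c j - ρ j| < δ := by
    refine (eventually_all.2 fun j =>
      (continuous_apply j).continuousAt.eventually_const_lt (hρpos j)).and ?_
    have hs : ∑ i, ρ i ≠ 0 := by rw [hρsum]; exact hCUpos.ne'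
    have : ContinuousAt (fun c : Fin J → ℝ => ∑ j, |C_U / (∑ i, c i) * c j - ρ j|) ρ := by
      refine tendsto_finsetSum _ fun j _ => ?_
      have hsc : ContinuousAt (fun c : Fin J → ℝ => ∑ i, c i) ρ :=
        (continuous_finsetSum _ fun i _ => continuous_apply i).continuousAt
      exact (((continuousAt_const.div hsc hs).mul (continuous_apply j).continuousAt).sub
        continuousAt_const).abs
    refine this.eventually_lt_const ?_
    simpa [hρsum, hCUpos.ne'] using hδ
  obtain ⟨N, hN, hNo, hρN⟩ := eventually_nhds_iff.1 hnear
  have hUcont : Continuous (fun z : (Fin J → ℝ) × (Fin J → ℝ) =>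
      ∑ j, U j (max (z.1 j) 0) (max (z.2 j) 0)) := by
    refine continuous_finsetSum _ fun j _ => ?_
    exact (hC2 j).continuousOn.comp_continuous
      (f := fun z : (Fin J → ℝ) × (Fin J → ℝ) => (max (z.1 j) 0, max (z.2 j) 0))
      (by fun_prop) fun z => ⟨le_max_right (z.1 j) 0, le_max_right (z.2 j) 0⟩
  have hmaxeq : ∀ x c : Fin J → ℝ, (∀ j, 0 ≤ x j) → (∀ j, 0 ≤ c j) →
      ∑ j, U j (max (x j) 0) (max (c j) 0) = ∑ j, U j (x j) (c j) := fun x c hx hc =>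
    Finset.sum_congr rfl fun j _ => by rw [max_eq_left (hx j), max_eq_left (hc j)]
  have hfar : ∀ᶠ x in 𝓝 (qstar ε), ∀ c ∈ R \ N,
      ∑ j, U j (max (x j) 0) (max (c j) 0) < ∑ j, U j (max (x j) 0) (max (ρ j) 0) := by
    refine (hRcomp.diff hNo).eventually_forall_of_forall_eventually fun c hc => ?_
    refine ContinuousAt.eventually_lt (f := fun z : (Fin J → ℝ) × (Fin J → ℝ) =>
      ∑ j, U j (max (z.1 j) 0) (max (z.2 j) 0)) (g := fun z : (Fin J → ℝ) × (Fin J → ℝ) =>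
      ∑ j, U j (max (z.1 j) 0) (max (ρ j) 0)) hUcont.continuousAt
      (hUcont.comp (f := fun z : (Fin J → ℝ) × (Fin J → ℝ) => (z.1, ρ))
        (by fun_prop)).continuousAt ?_
    rw [hmaxeq _ _ (fun j => (hppos j).le) (hRsub hc.1),
      hmaxeq _ _ (fun j => (hppos j).le) fun j => (hρpos j).le]
    exact hstrict ε hε c hc.1 fun h => hc.2 (h ▸ hρN)
  have hpos_near : ∀ᶠ x in 𝓝 (qstar ε), ∀ j, 0 < x j := eventually_all.2 fun j =>
    (continuous_apply j).continuousAt.eventually_const_lt (hppos j)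
  have hfull : ∀ᶠ x in 𝓝 (qstar ε), ∑ j, Λ x j = C_U := by
    filter_upwards [hfar, hpos_near] with x hx hxpos
    have hx0 : ∀ j, 0 ≤ x j := fun j => (hxpos j).le
    obtain ⟨hΛR, -⟩ := hΛmem x (hne0 x hxpos) hx0
    have hΛN : Λ x ∈ N := by
      by_contra h
      have h1 := hx (Λ x) ⟨hΛR, h⟩
      rw [hmaxeq _ _ hx0 (hRsub hΛR), hmaxeq _ _ hx0 fun j => (hρpos j).le] at h1
      have h2 := hΛmax x (hne0 x hxpos) hx0 ρ hρR fun j hj => absurd hj (hxpos j).ne'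
      linarith
    obtain ⟨hΛpos, hΛδ⟩ := hN _ hΛN
    refine le_antisymm (hCUub _ hΛR) (not_lt.1 fun hlt => ?_)
    have hs : 0 < ∑ j, Λ x j := Finset.sum_pos (fun j _ => hΛpos j) Finset.univ_nonempty
    have hr : 1 < C_U / ∑ j, Λ x j := (one_lt_div hs).2 hlt
    have hd0 : ∀ j, 0 ≤ C_U / (∑ i, Λ x i) * Λ x j := fun j =>
      mul_nonneg (by linarith) (hΛpos j).le
    have hdR := hδR (fun j => C_U / (∑ i, Λ x i) * Λ x j) hd0
      (by rw [← Finset.mul_sum]; field_simp) hΛδ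
    refine absurd (hΛmax x (hne0 x hxpos) hx0 _ hdR fun j hj => absurd hj (hxpos j).ne')
      (not_le.2 (Finset.sum_lt_sum_of_nonempty Finset.univ_nonempty fun j _ => ?_))
    exact hU2mono j _ (hxpos j) (hΛpos j).le (hd0 j) (lt_mul_of_one_lt_left (hΛpos j) hr)
  obtain ⟨r, hr, hball⟩ := Metric.eventually_nhds_iff.1 hfull
  refine ⟨r / 2, half_pos hr, fun q hq hqε hqσ => ?_⟩
  set w := ∑ j, q j / μ j with hw
  have hwpos : 0 < w := hε.trans_le hqε
  have ha : 0 < ε / w := div_pos hε hwpos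
  have ha1 : ε / w ≤ 1 := (div_le_one hwpos).2 hqε
  have hq0 : q ≠ 0 := by
    rintro rfl
    simp [hw] at hwpos
  rw [← hΛhom (ε / w) ha q hq0 hq]
  refine hball ((dist_pi_lt_iff hr).2 fun j => ?_)
  have hp : qstar ε = (ε / w) • qstar w := by
    rw [hhom w hwpos _ ha, div_mul_cancel₀ _ hwpos.ne']
  have hj : |q j - qstar w j| ≤ r / 2 :=
    (Finset.single_le_sum (f := fun j => |q j - qstar w j|) (fun _ _ => abs_nonneg _)
      (Finset.mem_univ j)).trans hqσ
  rw [hp, Real.dist_eq, Pi.smul_apply, Pi.smul_apply, ← smul_sub, smul_eq_mul, abs_mul,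
    abs_of_pos ha]
  have := mul_le_of_le_one_left (abs_nonneg (q j - qstar w j)) ha1
  linarith
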